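/- arXiv:1701.03194 — 4 statements merged into one kernel-verified Lean document; each statement's English description precedes it below -/
import Mathlib

section
/- Let Q be a real symmetric positive definite g×g matrix and let x ∈ ℝ^g. Then the supremum defining the tropical theta function is attained: there exists λ₀ ∈ ℤ^g such that λ₀ᵀQx − (1/2)·λ₀ᵀQλ₀ ≥ λᵀQx − (1/2)·λᵀQλ for all λ ∈ ℤ^g; i.e. Θ_Q(x) = max_{λ ∈ ℤ^g} (λᵀQx − (1/2)·λᵀQλ). -/
open Matrix

/-- The term `λᵀQx - (1/2)·λᵀQλ` appearing in the tropical theta function, for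
an integer vector `λ` viewed inside `ℝ^g`. -/
noncomputable def thetaTerm {g : ℕ} (Q : Matrix (Fin g) (Fin g) ℝ)
    (x : Fin g → ℝ) (lam : Fin g → ℤ) : ℝ :=
  (fun i => (lam i : ℝ)) ⬝ᵥ (Q *ᵥ x) -
    (1 / 2) * ((fun i => (lam i : ℝ)) ⬝ᵥ (Q *ᵥ fun i => (lam i : ℝ)))

open Filter

/-- A positive definite quadratic form on `ℝⁿ` dominates a positive multiple of the squared
norm. -/
theorem Matrix.PosDef.exists_pos_mul_norm_sq_le {n : Type*} [Fintype n] {Q : Matrix n n ℝ}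
    (hQ : Q.PosDef) : ∃ c : ℝ, 0 < c ∧ ∀ v : n → ℝ, c * ‖v‖ ^ 2 ≤ v ⬝ᵥ (Q *ᵥ v) := by
  have hcont : Continuous fun v : n → ℝ => v ⬝ᵥ (Q *ᵥ v) := by fun_prop
  obtain ⟨c, hc, hle⟩ := (isCompact_sphere (0 : n → ℝ) 1).exists_forall_le' (a := 0)
    hcont.continuousOn fun v hv => by
      have hv0 : v ≠ 0 := ne_zero_of_mem_unit_sphere ⟨v, hv⟩
      simpa using hQ.dotProduct_mulVec_pos hv0
  refine ⟨c, hc, fun v => ?_⟩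
  rcases eq_or_ne v 0 with rfl | hv
  · simp
  have hpos : 0 < ‖v‖ := norm_pos_iff.mpr hv
  have h := hle (‖v‖⁻¹ • v) (by simp [norm_smul, hpos.ne'])
  rw [mulVec_smul, smul_dotProduct, dotProduct_smul, smul_eq_mul, smul_eq_mul] at h
  calc c * ‖v‖ ^ 2 ≤ ‖v‖⁻¹ * (‖v‖⁻¹ * (v ⬝ᵥ (Q *ᵥ v))) * ‖v‖ ^ 2 := by gcongr
    _ = v ⬝ᵥ (Q *ᵥ v) := by field_simp

theorem dotProduct_le_norm_mul_sum_abs {n : Type*} [Fintype n] (v w : n → ℝ) :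
    v ⬝ᵥ w ≤ ‖v‖ * ∑ i, |w i| := by
  rw [dotProduct, Finset.mul_sum]
  refine Finset.sum_le_sum fun i _ => (le_abs_self _).trans ?_
  rw [abs_mul]
  gcongr
  exact norm_le_pi_norm v i

theorem norm_intCast_pi {n : Type*} [Fintype n] (lam : n → ℤ) :
    ‖fun i => (lam i : ℝ)‖ = ‖lam‖ := by
  simp [Pi.norm_def, ← Int.norm_cast_real, nnnorm]

theorem tendsto_thetaTerm_cofinite_atBot {g : ℕ} {Q : Matrix (Fin g) (Fin g) ℝ}
    (hQ : Q.PosDef) (x : Fin g → ℝ) : Tendsto (thetaTerm Q x) cofinite atBot := by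
  obtain ⟨c, hc, hle⟩ := hQ.exists_pos_mul_norm_sq_le
  have hnorm : Tendsto (fun lam : Fin g → ℤ => ‖lam‖) cofinite atTop := by
    rw [← cocompact_eq_cofinite]
    exact tendsto_norm_cocompact_atTop
  have hquad : Tendsto (fun t : ℝ => t * ((∑ i, |(Q *ᵥ x) i|) - c / 2 * t)) atTop atBot :=
    tendsto_id.atTop_mul_atBot₀ <| tendsto_atBot_add_const_left _ _ <|
      tendsto_neg_atTop_atBot.comp (tendsto_id.const_mul_atTop (half_pos hc))
  refine tendsto_atBot_mono (fun lam => ?_) (hquad.comp hnorm)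
  have h₁ := dotProduct_le_norm_mul_sum_abs (fun i => (lam i : ℝ)) (Q *ᵥ x)
  have h₂ := hle fun i => (lam i : ℝ)
  rw [norm_intCast_pi] at h₁ h₂
  simp only [thetaTerm, Function.comp_apply]
  linarith

/-- For positive definite `Q`, the supremum defining the tropical theta function
is attained: `Θ_Q(x) = max_{λ ∈ ℤ^g} (λᵀQx - (1/2)λᵀQλ)`. -/
theorem theta_sup_attained (g : ℕ) (Q : Matrix (Fin g) (Fin g) ℝ)
    (hQ : Q.PosDef) (x : Fin g → ℝ) :
    ∃ lam₀ : Fin g → ℤ, (∀ lam : Fin g → ℤ, thetaTerm Q x lam ≤ thetaTerm Q x lam₀) ∧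
      sSup (Set.range (thetaTerm Q x)) = thetaTerm Q x lam₀ := by
  obtain ⟨lam₀, h⟩ := (tendsto_thetaTerm_cofinite_atBot hQ x).exists_forall_ge
  exact ⟨lam₀, h, IsGreatest.csSup_eq ⟨⟨lam₀, rfl⟩, Set.forall_mem_range.mpr h⟩⟩
end

section
/- Let Q be a real symmetric positive semidefinite g×g matrix whose kernel {x ∈ ℝ^g : Qx = 0} is spanned by vectors with rational coordinates. Then for every x ∈ ℝ^g the supremum sup_{λ ∈ ℤ^g} (λᵀQx − (1/2)·λᵀQλ) is attained by some λ₀ ∈ ℤ^g. -/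
open Matrix

/-- `Q` has rational nullspace: its kernel `{x : Qx = 0}` is spanned by vectors
with rational coordinates. -/
def hasRationalKernel {g : ℕ} (Q : Matrix (Fin g) (Fin g) ℝ) : Prop :=
  ∃ S : Set (Fin g → ℝ), (∀ v ∈ S, ∀ i, ∃ q : ℚ, v i = (q : ℝ)) ∧
    Submodule.span ℝ S = LinearMap.ker Q.mulVecLin

/-- The real span of a set of rational vectors is the kernel of an integer matrix. -/
lemma exists_int_matrix_ker_eq_span {ι : Type*} [Fintype ι] [DecidableEq ι]
    (S : Set (ι → ℝ)) (hS : ∀ v ∈ S, ∀ i, ∃ q : ℚ, v i = (q : ℝ)) :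
    ∃ M : Matrix ι ι ℤ,
      LinearMap.ker (M.map (Int.cast : ℤ → ℝ)).mulVecLin = Submodule.span ℝ S := by
  let W : Submodule ℚ (ι → ℚ) := Submodule.span ℚ {w | (fun i => (w i : ℝ)) ∈ S}
  obtain ⟨f, hf⟩ := W.subtype.exists_leftInverse_of_injective W.ker_subtype
  let P : Matrix ι ι ℚ := LinearMap.toMatrix' (W.subtype ∘ₗ f)
  have hPmem (v : ι → ℚ) : P *ᵥ v ∈ W := by
    simp [P, LinearMap.toMatrix'_mulVec]
  have hPfix (w : ι → ℚ) (hw : w ∈ W) : P *ᵥ w = w := by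
    have := LinearMap.congr_fun hf ⟨w, hw⟩
    simp only [P, LinearMap.toMatrix'_mulVec]
    simpa using congrArg Subtype.val this
  have hcast (w : ι → ℚ) (hw : w ∈ W) : (fun i => (w i : ℝ)) ∈ Submodule.span ℝ S := by
    induction hw using Submodule.span_induction with
    | mem w h => exact Submodule.subset_span h
    | zero => convert Submodule.zero_mem (Submodule.span ℝ S) using 1; ext i; simp
    | add u v _ _ hu hv => convert Submodule.add_mem _ hu hv using 1; ext i; simp
    | smul a u _ hu =>
      convert Submodule.smul_mem _ (a : ℝ) hu using 1; ext i; simp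
  obtain ⟨D, hD⟩ := IsLocalization.exist_integer_multiples_of_finite (nonZeroDivisors ℤ)
    (fun p : ι × ι => (1 - P) p.1 p.2)
  choose m hm using hD
  have hD0 : ((D : ℤ) : ℝ) ≠ 0 := by
    exact_mod_cast nonZeroDivisors.coe_ne_zero D
  have hM : ((Matrix.of fun i j => m (i, j)).map (Int.cast : ℤ → ℝ)) =
      ((D : ℤ) : ℝ) • (1 - P.map (Rat.cast : ℚ → ℝ)) := by
    ext i j
    have h := congrArg (Rat.cast : ℚ → ℝ) (hm (i, j))
    simp only [Matrix.sub_apply, Matrix.one_apply, zsmul_eq_mul, algebraMap_int_eq,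
      eq_intCast, Rat.cast_intCast, Rat.cast_mul, Rat.cast_sub] at h
    simp only [Matrix.map_apply, Matrix.of_apply, Matrix.smul_apply, Matrix.sub_apply,
      Matrix.one_apply, smul_eq_mul, h]
    split_ifs <;> simp
  refine ⟨Matrix.of fun i j => m (i, j), ?_⟩
  have hker (y : ι → ℝ) : y ∈ LinearMap.ker
      ((Matrix.of fun i j => m (i, j)).map (Int.cast : ℤ → ℝ)).mulVecLin ↔
      P.map (Rat.cast : ℚ → ℝ) *ᵥ y = y := by
    rw [LinearMap.mem_ker, Matrix.mulVecLin_apply, hM, Matrix.smul_mulVec, smul_eq_zero,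
      or_iff_right hD0, Matrix.sub_mulVec, Matrix.one_mulVec, sub_eq_zero, eq_comm]
  apply le_antisymm
  · intro y hy
    rw [← (hker y).1 hy, Matrix.mulVec_eq_sum]
    refine Submodule.sum_mem _ fun j _ => ?_
    rw [op_smul_eq_smul]
    refine Submodule.smul_mem _ _ ?_
    have := hcast _ (hPmem (Pi.single j 1))
    rw [Matrix.mulVec_single_one] at this
    exact this
  · refine Submodule.span_le.2 fun v hv => ?_
    choose w hw using hS v hv
    obtain rfl : v = fun i => (w i : ℝ) := funext hw
    refine (hker _).2 ?_
    ext i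
    have h := congrArg (Rat.cast : ℚ → ℝ) (congrFun (hPfix w (Submodule.subset_span hv)) i)
    simpa [Matrix.mulVec, dotProduct] using h

/-- If `ker B ≤ ker M`, then the entries of `M y` are bounded in terms of those of `B y`. -/
lemma exists_mulVec_bound_of_ker_le {ι κ μ : Type*} [Fintype ι] [Fintype κ] [Fintype μ]
    (B : Matrix κ ι ℝ) (M : Matrix μ ι ℝ)
    (h : LinearMap.ker B.mulVecLin ≤ LinearMap.ker M.mulVecLin) :
    ∃ C : ℝ, ∀ y, ‖M *ᵥ y‖ ≤ C * ‖B *ᵥ y‖ := by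
  obtain ⟨T, hT⟩ := LinearMap.exists_extend
    ((LinearMap.ker B.mulVecLin).liftQ M.mulVecLin h ∘ₗ
      B.mulVecLin.quotKerEquivRange.symm.toLinearMap)
  refine ⟨‖T.toContinuousLinearMap‖, fun y => ?_⟩
  have hy : T (B *ᵥ y) = M *ᵥ y := by
    have := LinearMap.congr_fun hT (B.mulVecLin.quotKerEquivRange (Submodule.Quotient.mk y))
    simpa using this
  rw [← hy]
  exact T.toContinuousLinearMap.le_opNorm _

lemma thetaTerm_conjTranspose_mul_self {g : ℕ} (B : Matrix (Fin g) (Fin g) ℝ)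
    (x : Fin g → ℝ) (lam : Fin g → ℤ) :
    thetaTerm (Bᴴ * B) x lam = (B *ᵥ fun i => (lam i : ℝ)) ⬝ᵥ (B *ᵥ x) -
      (1 / 2) * ((B *ᵥ fun i => (lam i : ℝ)) ⬝ᵥ (B *ᵥ fun i => (lam i : ℝ))) := by
  simp only [thetaTerm, conjTranspose_eq_transpose_of_trivial, ← Matrix.mulVec_mulVec,
    Matrix.dotProduct_mulVec _ Bᵀ, Matrix.vecMul_transpose]

lemma norm_le_of_dotProduct_sub_nonneg {ι : Type*} [Fintype ι] (u w : ι → ℝ)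
    (h : 0 ≤ u ⬝ᵥ w - (1 / 2) * (u ⬝ᵥ u)) : ‖u‖ ≤ √(4 * (w ⬝ᵥ w)) := by
  have hsq : 0 ≤ (u - (2 : ℝ) • w) ⬝ᵥ (u - (2 : ℝ) • w) :=
    Finset.sum_nonneg fun i _ => mul_self_nonneg _
  simp only [sub_dotProduct, dotProduct_sub, smul_dotProduct, dotProduct_smul, smul_eq_mul,
    dotProduct_comm w u] at hsq
  refine (pi_norm_le_iff_of_nonneg (Real.sqrt_nonneg _)).2 fun i => Real.abs_le_sqrt ?_
  have hi : u i * u i ≤ u ⬝ᵥ u :=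
    Finset.single_le_sum (f := fun i => u i * u i) (fun i _ => mul_self_nonneg _)
      (Finset.mem_univ i)
  nlinarith

/-- For a symmetric positive semidefinite `Q` with rational nullspace, the
supremum defining the tropical theta function is attained for every `x`. -/
theorem theta_sup_attained_of_rational_kernel (g : ℕ)
    (Q : Matrix (Fin g) (Fin g) ℝ) (hQ : Q.PosSemidef)
    (hker : hasRationalKernel Q) :
    ∀ x : Fin g → ℝ, ∃ lam₀ : Fin g → ℤ,
      ∀ lam : Fin g → ℤ, thetaTerm Q x lam ≤ thetaTerm Q x lam₀ := by
  intro x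
  obtain ⟨S, hS, hspan⟩ := hker
  obtain ⟨M, hM⟩ := exists_int_matrix_ker_eq_span S hS
  obtain ⟨B, rfl⟩ : ∃ B : Matrix (Fin g) (Fin g) ℝ, Q = Bᴴ * B := by
    open scoped MatrixOrder in
    exact CStarAlgebra.nonneg_iff_eq_star_mul_self.mp hQ.nonneg
  rw [hspan, Matrix.ker_mulVecLin_conjTranspose_mul_self] at hM
  have hcast (lam : Fin g → ℤ) (i : Fin g) :
      (M.map (Int.cast : ℤ → ℝ) *ᵥ fun j => (lam j : ℝ)) i = ((M *ᵥ lam) i : ℝ) := by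
    simp [Matrix.mulVec, dotProduct]
  have hfactor : Function.FactorsThrough (thetaTerm (Bᴴ * B) x) (M *ᵥ ·) := by
    intro a b hab
    have hBab : B *ᵥ (fun i => (a i : ℝ)) = B *ᵥ fun i => (b i : ℝ) := by
      rw [← sub_eq_zero, ← Matrix.mulVec_sub, ← Matrix.mulVecLin_apply, ← LinearMap.mem_ker,
        ← hM, LinearMap.mem_ker, Matrix.mulVecLin_apply, Matrix.mulVec_sub, sub_eq_zero]
      ext i
      rw [hcast, hcast]
      exact congrArg _ (congrFun hab i)
    simp only [thetaTerm_conjTranspose_mul_self, hBab]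
  obtain ⟨C, hC⟩ := exists_mulVec_bound_of_ker_le B _ hM.ge
  have hfin : ((M *ᵥ ·) '' {lam | 0 ≤ thetaTerm (Bᴴ * B) x lam}).Finite := by
    let R := |C| * √(4 * ((B *ᵥ x) ⬝ᵥ (B *ᵥ x)))
    refine (Set.finite_Icc (fun _ => -⌈R⌉) (fun _ => ⌈R⌉)).subset ?_
    rintro _ ⟨lam, hlam, rfl⟩
    rw [Set.mem_ofPred_eq, thetaTerm_conjTranspose_mul_self] at hlam
    have hle (i : Fin g) : |((M *ᵥ lam) i : ℝ)| ≤ R := by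
      rw [← hcast, ← Real.norm_eq_abs]
      refine (norm_le_pi_norm _ i).trans ((hC _).trans ?_)
      exact mul_le_mul (le_abs_self C) (norm_le_of_dotProduct_sub_nonneg _ _ hlam)
        (norm_nonneg _) (abs_nonneg C)
    have hint (i : Fin g) : |(M *ᵥ lam) i| ≤ ⌈R⌉ := by
      exact_mod_cast (hle i).trans (Int.le_ceil R)
    exact ⟨fun i => (abs_le.1 (hint i)).1, fun i => (abs_le.1 (hint i)).2⟩
  have hzero : thetaTerm (Bᴴ * B) x 0 = 0 := by
    have h0 : (fun i => (((0 : Fin g → ℤ) i : ℤ) : ℝ)) = 0 := by ext; simp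
    rw [thetaTerm, h0]
    simp
  obtain ⟨_, ⟨lam₀, hlam₀, rfl⟩, hmax⟩ := Set.exists_max_image _
    (Function.extend (M *ᵥ ·) (thetaTerm (Bᴴ * B) x) 0) hfin ⟨_, 0, hzero.ge, rfl⟩
  refine ⟨lam₀, fun lam => ?_⟩
  rcases le_total 0 (thetaTerm (Bᴴ * B) x lam) with h | h
  · have := hmax _ ⟨lam, h, rfl⟩
    rwa [hfactor.extend_apply, hfactor.extend_apply] at this
  · exact h.trans hlam₀
end

section
/- Let Q be a real symmetric positive semidefinite g×g matrix whose kernel is spanned by vectors with rational coordinates, and let g' be the rank of Q. Then there exists a g×g integer matrix X with determinant ±1 such that the congruent matrix Q' = XᵀQX (with X viewed as a real matrix) has block-diagonal form: the top-left g'×g' submatrix of Q' is positive definite, and every entry Q'_{ij} with i > g' or j > g' is zero. -/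
open Matrix

/-- A real vector with rational coordinates has a nonzero integer multiple with integer
coordinates. -/
lemma exists_int_smul_eq_intCast {ι : Type*} [Finite ι] {v : ι → ℝ}
    (hv : ∀ i, ∃ q : ℚ, v i = q) :
    ∃ (d : ℤ) (z : ι → ℤ), d ≠ 0 ∧ (d : ℝ) • v = fun i ↦ (z i : ℝ) := by
  choose q hq using hv
  obtain ⟨d, hd⟩ := IsLocalization.exist_integer_multiples_of_finite (nonZeroDivisors ℤ) q
  choose z hz using hd
  refine ⟨d, z, nonZeroDivisors.coe_ne_zero d, funext fun i ↦ ?_⟩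
  have h : (z i : ℚ) = d * q i := by simpa using hz i
  simp only [Pi.smul_apply, smul_eq_mul, hq]
  exact_mod_cast h.symm

/-- A real subspace spanned by rational vectors becomes a coordinate subspace after a unimodular
integral change of basis. -/
lemma exists_unimodular_mulVec_mem_iff {ι : Type*} [Fintype ι] [DecidableEq ι]
    (S : Set (ι → ℝ)) (hS : ∀ v ∈ S, ∀ i, ∃ q : ℚ, v i = q) :
    ∃ (X : Matrix ι ι ℤ) (s : Set ι), IsUnit X.det ∧
      ∀ x : ι → ℝ, X.map (Int.castRingHom ℝ) *ᵥ x ∈ Submodule.span ℝ S ↔ ∀ i ∉ s, x i = 0 := by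
  let L : Submodule ℤ (ι → ℤ) := ((Submodule.span ℝ S).restrictScalars ℤ).comap
    ((Int.castRingHom ℝ).toAddMonoidHom.toIntLinearMap.compLeft ι)
  have mem_L (z : ι → ℤ) : z ∈ L ↔ (fun i ↦ (z i : ℝ)) ∈ Submodule.span ℝ S := Iff.rfl
  obtain ⟨n, snf⟩ := L.smithNormalForm (Pi.basisFun ℤ ι)
  let X : Matrix ι ι ℤ := (Pi.basisFun ℤ ι).toMatrix snf.bM
  have hX : IsUnit X.det := (isUnit_iff_isUnit_det X).1 <| by
    have := (Pi.basisFun ℤ ι).invertibleToMatrix snf.bM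
    exact isUnit_of_invertible X
  have hXR : IsUnit (X.map (Int.castRingHom ℝ)) := by
    rw [isUnit_iff_isUnit_det, ← RingHom.mapMatrix_apply, ← RingHom.map_det]
    exact hX.map _
  have hinj := mulVec_injective_of_isUnit hXR
  have hrepr (z : ι → ℤ) : X.map (Int.castRingHom ℝ) *ᵥ (fun i ↦ (snf.bM.repr z i : ℝ)) =
      fun i ↦ (z i : ℝ) := by
    funext i
    have h := RingHom.map_mulVec (Int.castRingHom ℝ) X (snf.bM.repr z) i
    rw [snf.bM.toMatrix_mulVec_repr (Pi.basisFun ℤ ι) z] at h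
    exact h.symm
  have hcol (j : Fin n) : (X.map (Int.castRingHom ℝ)).col (snf.f j) ∈ Submodule.span ℝ S := by
    have hne : (snf.a j : ℝ) ≠ 0 := by
      intro h
      refine snf.bN.ne_zero j (Subtype.ext ?_)
      rw [snf.snf, Int.cast_eq_zero.1 h, zero_smul, ZeroMemClass.coe_zero]
    have h := (mem_L _).1 (snf.bN j).2
    rw [snf.snf] at h
    refine (Submodule.smul_mem_iff _ hne).1 ?_
    convert h using 1
    ext i
    simp [X, Module.Basis.toMatrix_apply]
  refine ⟨X, Set.range snf.f, hX, fun x ↦ ⟨fun hx ↦ ?_, fun hx ↦ ?_⟩⟩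
  · have hle : Submodule.span ℝ S ≤ (Submodule.pi (Set.range snf.f)ᶜ fun _ ↦ ⊥).map
        (X.map (Int.castRingHom ℝ)).mulVecLin := by
      refine Submodule.span_le.2 fun v hv ↦ ?_
      obtain ⟨d, z, hd, hz⟩ := exists_int_smul_eq_intCast (hS v hv)
      have hzL : z ∈ L := (mem_L z).2 (hz ▸ Submodule.smul_mem _ _ (Submodule.subset_span hv))
      have hd' : (d : ℝ) ≠ 0 := by exact_mod_cast hd
      refine (Submodule.smul_mem_iff _ hd').1 ⟨fun i ↦ (snf.bM.repr z i : ℝ), ?_, ?_⟩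
      · intro i hi
        simpa using snf.repr_eq_zero_of_notMem_range ⟨z, hzL⟩ hi
      · rw [hz, mulVecLin_apply, hrepr]
    obtain ⟨w, hw, hwx⟩ := hle hx
    obtain rfl := hinj hwx
    exact fun i hi ↦ hw i hi
  · rw [mulVec_eq_sum]
    refine Submodule.sum_mem _ fun i _ ↦ ?_
    by_cases hi : i ∈ Set.range snf.f
    · obtain ⟨j, rfl⟩ := hi
      rw [op_smul_eq_smul]
      exact Submodule.smul_mem _ _ (hcol j)
    · simp [hx i hi]

/-- The coordinate subspace in `exists_unimodular_mulVec_mem_iff` can be taken to consist of the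
vectors supported on the last coordinates. -/
lemma exists_unimodular_mulVec_mem_iff_fin {g : ℕ}
    (S : Set (Fin g → ℝ)) (hS : ∀ v ∈ S, ∀ i, ∃ q : ℚ, v i = q) :
    ∃ X : Matrix (Fin g) (Fin g) ℤ, IsUnit X.det ∧
      ∀ x : Fin g → ℝ, X.map (Int.castRingHom ℝ) *ᵥ x ∈ Submodule.span ℝ S ↔
        ∀ i : Fin g, (i : ℕ) + Module.finrank ℝ (Submodule.span ℝ S) < g → x i = 0 := by
  classical
  obtain ⟨X, s, hX, hmem⟩ := exists_unimodular_mulVec_mem_iff S hS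
  have hXR : IsUnit (X.map (Int.castRingHom ℝ)).det := by
    rw [← RingHom.mapMatrix_apply, ← RingHom.map_det]
    exact hX.map _
  have hcard : s.ncard = Module.finrank ℝ (Submodule.span ℝ S) := by
    rw [← Pi.dim_spanSubset (R := ℝ)]
    let E := (X.map (Int.castRingHom ℝ)).toLinearEquiv' (invertibleOfIsUnitDet _ hXR)
    have : Pi.spanSubset ℝ s = (Submodule.span ℝ S).comap E.toLinearMap := by
      ext x
      rw [Pi.mem_spanSubset_iff]
      exact (hmem x).symm
    rw [this]
    exact (E.ofSubmodule' _).finrank_eq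
  set r := Module.finrank ℝ (Submodule.span ℝ S)
  have hr : r ≤ g := by simpa using (Submodule.span ℝ S).finrank_le
  have he : Fintype.card {i : Fin g // ¬ (i : ℕ) + r < g} = Fintype.card {i : Fin g // i ∈ s} := by
    have h : Fintype.card {i : Fin g // (i : ℕ) + r < g} = g - r := by
      simp_rw [← Nat.lt_sub_iff_add_lt]
      rw [Fintype.card_subtype, Fin.card_filter_val_lt, min_eq_right (Nat.sub_le _ _)]
    rw [Fintype.card_subtype_compl, h, Fintype.card_fin, ← Nat.card_eq_fintype_card (α := s),
      Nat.card_coe_set_eq, hcard]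
    omega
  let e : Equiv.Perm (Fin g) := (Fintype.equivOfCardEq he).extendSubtype
  have hes (i : Fin g) : e i ∉ s ↔ (i : ℕ) + r < g := by
    by_cases hi : (i : ℕ) + r < g
    · simpa [hi] using (Fintype.equivOfCardEq he).extendSubtype_not_mem i (by simpa using hi)
    · simpa [hi] using (Fintype.equivOfCardEq he).extendSubtype_mem i hi
  refine ⟨X.submatrix id e, ?_, fun x ↦ ?_⟩
  · rw [det_permute']
    exact ((Int.isUnit_iff.2 (by rcases Int.units_eq_one_or e.sign with h | h <;> simp [h]))).mul hX
  · have : (X.submatrix id e).map (Int.castRingHom ℝ) *ᵥ x =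
        X.map (Int.castRingHom ℝ) *ᵥ (x ∘ e.symm) := by
      rw [← submatrix_map, submatrix_mulVec_equiv, Function.comp_id]
    rw [this, hmem, e.symm.forall_congr_left]
    simp [hes]

/-- A symmetric positive semidefinite matrix with rational nullspace of rank `g'`
is `GL_g(ℤ)`-congruent to a block-diagonal matrix whose top-left `g' × g'` block
is positive definite and all other entries vanish: there is an integer matrix `X`
of determinant `±1` such that `Q' = XᵀQX` satisfies `xᵀQ'x > 0` for every nonzero
vector `x` supported on the first `g'` coordinates, and `Q'ᵢⱼ = 0` whenever
`i ≥ g'` or `j ≥ g'`. -/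
theorem rational_psd_block_diagonal_form (g : ℕ) (Q : Matrix (Fin g) (Fin g) ℝ)
    (hQsymm : Q.IsSymm) (hQ : Q.PosSemidef) (hker : hasRationalKernel Q)
    (g' : ℕ) (hg' : g' = Q.rank) :
    ∃ X : Matrix (Fin g) (Fin g) ℤ, (X.det = 1 ∨ X.det = -1) ∧
      (∀ x : Fin g → ℝ, x ≠ 0 → (∀ i : Fin g, g' ≤ (i : ℕ) → x i = 0) →
        0 < x ⬝ᵥ (((X.map (fun a => (a : ℝ)))ᵀ * Q * X.map (fun a => (a : ℝ))) *ᵥ x)) ∧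
      (∀ i j : Fin g, g' ≤ (i : ℕ) ∨ g' ≤ (j : ℕ) →
        ((X.map (fun a => (a : ℝ)))ᵀ * Q * X.map (fun a => (a : ℝ))) i j = 0) := by
  obtain ⟨S, hS, hSker⟩ := hker
  obtain ⟨X, hX, hmem⟩ := exists_unimodular_mulVec_mem_iff_fin S hS
  have hrank : Q.rank + Module.finrank ℝ (Submodule.span ℝ S) = g := by
    rw [hSker]
    simpa [Matrix.rank] using Q.mulVecLin.finrank_range_add_finrank_ker
  have hlt (i : Fin g) : (i : ℕ) + Module.finrank ℝ (Submodule.span ℝ S) < g ↔ (i : ℕ) < g' := by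
    omega
  simp only [hlt, hSker, LinearMap.mem_ker, mulVecLin_apply] at hmem
  change ∃ X : Matrix (Fin g) (Fin g) ℤ, (X.det = 1 ∨ X.det = -1) ∧
    (∀ x : Fin g → ℝ, x ≠ 0 → (∀ i : Fin g, g' ≤ (i : ℕ) → x i = 0) →
      0 < x ⬝ᵥ (((X.map (Int.castRingHom ℝ))ᵀ * Q * X.map (Int.castRingHom ℝ)) *ᵥ x)) ∧
    (∀ i j : Fin g, g' ≤ (i : ℕ) ∨ g' ≤ (j : ℕ) →
      ((X.map (Int.castRingHom ℝ))ᵀ * Q * X.map (Int.castRingHom ℝ)) i j = 0)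
  refine ⟨X, Int.isUnit_iff.1 hX, fun x hx0 hx ↦ ?_, ?_⟩
  · have hY : x ⬝ᵥ (((X.map (Int.castRingHom ℝ))ᵀ * Q * X.map (Int.castRingHom ℝ)) *ᵥ x) =
        star (X.map (Int.castRingHom ℝ) *ᵥ x) ⬝ᵥ (Q *ᵥ (X.map (Int.castRingHom ℝ) *ᵥ x)) := by
      rw [star_trivial, ← mulVec_mulVec, ← mulVec_mulVec, dotProduct_mulVec, vecMul_transpose]
    rw [hY]
    refine (hQ.dotProduct_mulVec_nonneg _).lt_of_ne' fun h ↦ hx0 (funext fun i ↦ ?_)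
    rw [hQ.dotProduct_mulVec_zero_iff, hmem] at h
    exact (lt_or_ge (i : ℕ) g').elim (h i) (hx i)
  · set Y := X.map (Int.castRingHom ℝ)
    have hzero (i j : Fin g) (hj : g' ≤ (j : ℕ)) : (Yᵀ * Q * Y) i j = 0 := by
      have h : Q *ᵥ (Y *ᵥ Pi.single j 1) = 0 :=
        (hmem _).2 fun k hk ↦ Pi.single_eq_of_ne (by omega) _
      have h' : (Yᵀ * Q * Y) *ᵥ Pi.single j 1 = 0 := by
        rw [← mulVec_mulVec, ← mulVec_mulVec, h, mulVec_zero]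
      simpa using congrFun h' i
    have hsymm : (Yᵀ * Q * Y).IsSymm := by
      simp [IsSymm, transpose_mul, hQsymm.eq, Matrix.mul_assoc]
    rintro i j (hi | hj)
    · rw [← hsymm.apply]
      exact hzero j i hi
    · exact hzero i j hj
end

section
/- Every real symmetric positive semidefinite 2×2 matrix Q whose kernel is spanned by vectors with rational coordinates is GL₂(ℤ)-congruent to a matrix in the closed secondary cone of the principal Delaunay subdivision: there exist a 2×2 integer matrix X with determinant ±1 and real numbers a, b, c ≥ 0 such that XᵀQX = [[a + c, −c], [−c, b + c]]. -/
open Matrix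

/-- The bilinear form `p x z + q (x w + y z) + r y w` of the symmetric matrix `[[p, q], [q, r]]`,
evaluated at the integer vectors `(x, y)` and `(z, w)`. -/
def binaryForm (p q r : ℝ) (x y z w : ℤ) : ℝ :=
  p * x * z + q * (x * w + y * z) + r * y * w

theorem congruent_secondaryCone_of_basis {Q : Matrix (Fin 2) (Fin 2) ℝ} (hQ : Q.IsSymm)
    {x y z w : ℤ} (hdet : x * w - z * y = 1 ∨ x * w - z * y = -1)
    (hB : binaryForm (Q 0 0) (Q 0 1) (Q 1 1) x y z w ≤ 0)
    (hA : 0 ≤ binaryForm (Q 0 0) (Q 0 1) (Q 1 1) x y x y +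
      binaryForm (Q 0 0) (Q 0 1) (Q 1 1) x y z w)
    (hC : 0 ≤ binaryForm (Q 0 0) (Q 0 1) (Q 1 1) z w z w +
      binaryForm (Q 0 0) (Q 0 1) (Q 1 1) x y z w) :
    ∃ X : Matrix (Fin 2) (Fin 2) ℤ, (X.det = 1 ∨ X.det = -1) ∧
      ∃ a b c : ℝ, 0 ≤ a ∧ 0 ≤ b ∧ 0 ≤ c ∧
        (X.map (fun x => (x : ℝ)))ᵀ * Q * X.map (fun x => (x : ℝ)) =
          !![a + c, -c; -c, b + c] := by
  refine ⟨!![x, z; y, w], by simpa [Matrix.det_fin_two] using hdet, _, _, _, hA, hC,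
    neg_nonneg.2 hB, ?_⟩
  have h10 : Q 1 0 = Q 0 1 := hQ.apply 0 1
  ext i j
  fin_cases i <;> fin_cases j <;>
    simp [Matrix.mul_apply, Fin.sum_univ_two, h10, binaryForm] <;> ring

theorem sq_le_of_binaryForm_le {p q r C : ℝ} (hp : 0 < p) (hr : 0 < r)
    (hd : 0 < p * r - q ^ 2) {x y : ℤ} (h : binaryForm p q r x y x y ≤ C) :
    (x : ℝ) ^ 2 ≤ (p + r) * C / (p * r - q ^ 2) ∧
      (y : ℝ) ^ 2 ≤ (p + r) * C / (p * r - q ^ 2) := by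
  have hx : r * binaryForm p q r x y x y = (q * x + r * y) ^ 2 + (p * r - q ^ 2) * x ^ 2 := by
    unfold binaryForm; ring
  have hy : p * binaryForm p q r x y x y = (p * x + q * y) ^ 2 + (p * r - q ^ 2) * y ^ 2 := by
    unfold binaryForm; ring
  have h1 := mul_le_mul_of_nonneg_left h hp.le
  have h2 := mul_le_mul_of_nonneg_left h hr.le
  have h3 : 0 ≤ binaryForm p q r x y x y := by
    by_contra! h3
    nlinarith [mul_pos hr (neg_pos.2 h3), sq_nonneg (q * x + r * y),
      mul_nonneg hd.le (sq_nonneg (x : ℝ))]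
  have h4 : 0 ≤ p * C := mul_nonneg hp.le (h3.trans h)
  have h5 : 0 ≤ r * C := mul_nonneg hr.le (h3.trans h)
  constructor <;> rw [le_div_iff₀ hd]
  · nlinarith [sq_nonneg (q * x + r * y)]
  · nlinarith [sq_nonneg (p * x + q * y)]

theorem binaryForm_self_nonneg {p q r : ℝ} (hr : 0 < r)
    (hd : 0 < p * r - q ^ 2) (x y : ℤ) : 0 ≤ binaryForm p q r x y x y := by
  have hx : r * binaryForm p q r x y x y = (q * x + r * y) ^ 2 + (p * r - q ^ 2) * x ^ 2 := by
    unfold binaryForm; ring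
  exact nonneg_of_mul_nonneg_right (hx ▸ by positivity) hr

/-- A positive definite binary form attains the minimum of its trace over all bases of `ℤ²`. -/
theorem exists_basis_min_trace {p q r : ℝ} (hp : 0 < p) (hr : 0 < r)
    (hd : 0 < p * r - q ^ 2) :
    ∃ x y z w : ℤ, (x * w - z * y = 1 ∨ x * w - z * y = -1) ∧
      ∀ x' y' z' w' : ℤ, (x' * w' - z' * y' = 1 ∨ x' * w' - z' * y' = -1) →
        binaryForm p q r x y x y + binaryForm p q r z w z w ≤
          binaryForm p q r x' y' x' y' + binaryForm p q r z' w' z' w' := by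
  let T : ℤ × ℤ × ℤ × ℤ → ℝ := fun v =>
    binaryForm p q r v.1 v.2.1 v.1 v.2.1 +
      binaryForm p q r v.2.2.1 v.2.2.2 v.2.2.1 v.2.2.2
  let s : Set (ℤ × ℤ × ℤ × ℤ) := {v | (v.1 * v.2.2.2 - v.2.2.1 * v.2.1 = 1 ∨
    v.1 * v.2.2.2 - v.2.2.1 * v.2.1 = -1) ∧ T v ≤ p + r}
  have hfin : s.Finite := by
    obtain ⟨N, hN⟩ := exists_nat_ge ((p + r) * (p + r) / (p * r - q ^ 2))
    have key : ∀ x : ℤ, (x : ℝ) ^ 2 ≤ (p + r) * (p + r) / (p * r - q ^ 2) →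
        -(N : ℤ) ≤ x ∧ x ≤ N := by
      intro x hx
      have h : x ^ 2 ≤ (N : ℤ) := by exact_mod_cast hx.trans hN
      constructor <;> nlinarith [Int.le_self_sq x, Int.le_self_sq (-x)]
    refine (Set.finite_Icc ((-N, -N, -N, -N) : ℤ × ℤ × ℤ × ℤ) (N, N, N, N)).subset ?_
    rintro ⟨x, y, z, w⟩ ⟨-, hT⟩
    simp only [T] at hT
    have h1 := binaryForm_self_nonneg hr hd x y
    have h2 := binaryForm_self_nonneg hr hd z w
    obtain ⟨hx, hy⟩ := sq_le_of_binaryForm_le hp hr hd (x := x) (y := y) (C := p + r) (by linarith)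
    obtain ⟨hz, hw⟩ := sq_le_of_binaryForm_le hp hr hd (x := z) (y := w) (C := p + r) (by linarith)
    exact ⟨⟨(key x hx).1, (key y hy).1, (key z hz).1, (key w hw).1⟩,
      ⟨(key x hx).2, (key y hy).2, (key z hz).2, (key w hw).2⟩⟩
  have hone : T (1, 0, 0, 1) = p + r := by simp [T, binaryForm]
  obtain ⟨⟨x, y, z, w⟩, hv, hmin⟩ :=
    Set.exists_min_image s T hfin ⟨(1, 0, 0, 1), by simp, hone.le⟩
  refine ⟨x, y, z, w, hv.1, fun x' y' z' w' h' => ?_⟩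
  by_cases hT : T (x', y', z', w') ≤ p + r
  · exact hmin (x', y', z', w') ⟨h', hT⟩
  · exact hv.2.trans (not_le.1 hT).le

/-- A basis of `ℤ²` of minimal trace is, up to a sign, reduced in the sense of Selling. -/
theorem exists_reduced_basis {p q r : ℝ} (hp : 0 < p) (hr : 0 < r)
    (hd : 0 < p * r - q ^ 2) :
    ∃ x y z w : ℤ, (x * w - z * y = 1 ∨ x * w - z * y = -1) ∧
      binaryForm p q r x y z w ≤ 0 ∧
      0 ≤ binaryForm p q r x y x y + binaryForm p q r x y z w ∧
      0 ≤ binaryForm p q r z w z w + binaryForm p q r x y z w := by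
  obtain ⟨x, y, z, w, hdet, hmin⟩ := exists_basis_min_trace hp hr hd
  have h1 := hmin x y (z + x) (w + y) (by ring_nf at hdet ⊢; exact hdet)
  have h2 := hmin (x + z) (y + w) z w (by ring_nf at hdet ⊢; exact hdet)
  have h3 := hmin x y (z - x) (w - y) (by ring_nf at hdet ⊢; exact hdet)
  have h4 := hmin (x - z) (y - w) z w (by ring_nf at hdet ⊢; exact hdet)
  rcases le_total (binaryForm p q r x y z w) 0 with hB | hB
  · refine ⟨x, y, z, w, hdet, hB, ?_, ?_⟩ <;>
      (unfold binaryForm at *; push_cast at *; linarith)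
  · refine ⟨x, y, -z, -w, by rcases hdet with h | h <;> [right; left] <;> linarith, ?_, ?_, ?_⟩ <;>
      (unfold binaryForm at *; push_cast at *; linarith)

theorem exists_rational_ker_of_det_eq_zero {g : ℕ} {Q : Matrix (Fin g) (Fin g) ℝ}
    (hker : hasRationalKernel Q) (hdet : Q.det = 0) :
    ∃ v : Fin g → ℚ, v ≠ 0 ∧ Q *ᵥ (fun i => (v i : ℝ)) = 0 := by
  obtain ⟨S, hS, hspan⟩ := hker
  obtain ⟨u, hu, hQu⟩ := Matrix.exists_mulVec_eq_zero_iff.2 hdet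
  have hmem : u ∈ Submodule.span ℝ S := by
    rw [hspan, LinearMap.mem_ker, Matrix.mulVecLin_apply, hQu]
  obtain ⟨v, hvS, hv⟩ : ∃ v ∈ S, v ≠ 0 := by
    by_contra! h
    rw [Submodule.span_eq_bot.2 h] at hmem
    exact hu hmem
  choose f hf using hS v hvS
  have hfv : (fun i => (f i : ℝ)) = v := funext fun i => (hf i).symm
  refine ⟨f, ?_, ?_⟩
  · rintro rfl
    exact hv (by rw [← hfv]; ext; simp)
  · have : v ∈ LinearMap.ker Q.mulVecLin := hspan ▸ Submodule.subset_span hvS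
    rw [hfv]
    exact this

theorem exists_isCoprime_proportional {v : Fin 2 → ℚ} (hv : v ≠ 0) :
    ∃ (m n : ℤ) (k : ℚ), IsCoprime m n ∧ k ≠ 0 ∧ v 0 = k * m ∧ v 1 = k * n := by
  by_cases h1 : v 1 = 0
  · refine ⟨1, 0, v 0, isCoprime_one_left, fun h0 => hv ?_, by simp, by simp [h1]⟩
    ext i
    fin_cases i <;> simp [h0, h1]
  · have hden : ((v 0 / v 1).den : ℚ) ≠ 0 := by exact_mod_cast (v 0 / v 1).den_ne_zero
    refine ⟨(v 0 / v 1).num, (v 0 / v 1).den, v 1 / (v 0 / v 1).den,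
      Rat.isCoprime_num_den _, div_ne_zero h1 hden, ?_, ?_⟩
    · calc v 0 = v 1 * (v 0 / v 1) := by field_simp
        _ = v 1 * ((v 0 / v 1).num / (v 0 / v 1).den) := by rw [Rat.num_div_den]
        _ = _ := by ring
    · push_cast
      field_simp

/-- Every symmetric positive semidefinite `2 × 2` real matrix with rational
nullspace is `GL₂(ℤ)`-congruent to a matrix `[[a + c, -c], [-c, b + c]]` with
`a, b, c ≥ 0`. -/
theorem genus_two_voronoi_reduction (Q : Matrix (Fin 2) (Fin 2) ℝ)
    (hQsymm : Q.IsSymm) (hQ : Q.PosSemidef) (hker : hasRationalKernel Q) :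
    ∃ X : Matrix (Fin 2) (Fin 2) ℤ, (X.det = 1 ∨ X.det = -1) ∧
      ∃ a b c : ℝ, 0 ≤ a ∧ 0 ≤ b ∧ 0 ≤ c ∧
        (X.map (fun x => (x : ℝ)))ᵀ * Q * X.map (fun x => (x : ℝ)) =
          !![a + c, -c; -c, b + c] := by
  have h10 : Q 1 0 = Q 0 1 := hQsymm.apply 0 1
  have hdet : Q.det = Q 0 0 * Q 1 1 - Q 0 1 ^ 2 := by
    rw [Matrix.det_fin_two, h10, sq]
  have hp : 0 ≤ Q 0 0 := hQ.diag_nonneg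
  have hr : 0 ≤ Q 1 1 := hQ.diag_nonneg
  rcases hQ.det_nonneg.eq_or_lt with h0 | hpos
  · obtain ⟨v, hv, hQv⟩ := exists_rational_ker_of_det_eq_zero hker h0.symm
    obtain ⟨m, n, k, ⟨s, t, hst⟩, hk, hm, hn⟩ := exists_isCoprime_proportional hv
    have hkR : (k : ℝ) ≠ 0 := by exact_mod_cast hk
    have e0 : Q 0 0 * m + Q 0 1 * n = 0 := by
      have h := congrFun hQv 0
      simp only [Matrix.mulVec, dotProduct, Fin.sum_univ_two, hm, hn, Pi.zero_apply] at h
      push_cast at h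
      exact mul_left_cancel₀ hkR (by linarith)
    have e1 : Q 0 1 * m + Q 1 1 * n = 0 := by
      have h := congrFun hQv 1
      simp only [Matrix.mulVec, dotProduct, Fin.sum_univ_two, hm, hn, Pi.zero_apply, h10] at h
      push_cast at h
      exact mul_left_cancel₀ hkR (by linarith)
    have hB (x y : ℤ) : binaryForm (Q 0 0) (Q 0 1) (Q 1 1) x y m n = 0 := by
      unfold binaryForm
      linear_combination (x : ℝ) * e0 + (y : ℝ) * e1
    have hA (x y : ℤ) : 0 ≤ binaryForm (Q 0 0) (Q 0 1) (Q 1 1) x y x y := by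
      have h := hQ.dotProduct_mulVec_nonneg ![(x : ℝ), (y : ℝ)]
      simp [Matrix.mulVec, dotProduct, Fin.sum_univ_two, h10] at h
      unfold binaryForm
      linarith
    exact congruent_secondaryCone_of_basis hQsymm (x := t) (y := -s) (z := m) (w := n)
      (Or.inl (by linarith)) (hB _ _).le (by rw [hB, add_zero]; exact hA _ _)
      (by rw [hB, hB, add_zero])
  · rw [hdet] at hpos
    have hp' : 0 < Q 0 0 := hp.lt_of_ne fun h => by nlinarith [sq_nonneg (Q 0 1)]
    have hr' : 0 < Q 1 1 := hr.lt_of_ne fun h => by nlinarith [sq_nonneg (Q 0 1)]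
    obtain ⟨x, y, z, w, hX, hB, hA, hC⟩ := exists_reduced_basis hp' hr' hpos
    exact congruent_secondaryCone_of_basis hQsymm hX hB hA hC
end
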